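/- arXiv:math/0302235 — 7 statements merged into one kernel-verified Lean document; each statement's English description precedes it below -/
import Mathlib

section
/- Let A be a Noetherian commutative ring and F ⊆ A a filter. Then the complement of F is a union of prime ideals of height at most 1; concretely, for every a ∈ A with a ∉ F there exists a prime ideal p of A with a ∈ p, p ∩ F = ∅, and the height of p is at most 1. -/
/-- A *filter* in a commutative monoid: it contains `1`, is closed under
multiplication, and is closed under divisors. -/
def IsMulFilter {A : Type*} [CommMonoid A] (F : Set A) : Prop :=
  1 ∈ F ∧ (∀ f ∈ F, ∀ g ∈ F, f * g ∈ F) ∧ (∀ f ∈ F, ∀ g : A, g ∣ f → g ∈ F)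

theorem stmt1 {A : Type*} [CommRing A] [IsNoetherianRing A]
    (F : Set A) (hF : IsMulFilter F) (a : A) (ha : a ∉ F) :
    ∃ (p : Ideal A) (hp : p.IsPrime), a ∈ p ∧ (∀ x ∈ p, x ∉ F) ∧
      Order.height (⟨p, hp⟩ : PrimeSpectrum A) ≤ 1 := by
  obtain ⟨h_one, h_mul, h_dvd⟩ := hF
  let S : Submonoid A := ⟨⟨F, fun {x y} hx hy => h_mul x hx y hy⟩, h_one⟩
  have h_disj : Disjoint (Ideal.span {a} : Set A) S :=
    Set.disjoint_left.mpr fun x hx hxF =>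
      ha (h_dvd x hxF a (Ideal.mem_span_singleton.mp hx))
  obtain ⟨P, hP, haP, hPF⟩ := Ideal.exists_le_prime_disjoint _ S h_disj
  obtain ⟨p, hp, hpP⟩ := Ideal.exists_minimalPrimes_le haP
  have hp_prime : p.IsPrime := hp.1.1
  refine ⟨p, hp_prime, hp.1.2 (Ideal.mem_span_singleton_self a),
    fun x hx hxF => Set.disjoint_left.mp hPF (hpP hx) hxF, ?_⟩
  rw [← PrimeSpectrum.height_eq_orderHeight]
  exact Ideal.height_le_one_of_isPrincipal_of_mem_minimalPrimes _ p hp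
end

section
/- Let M be a commutative reduced monoid with an absorbing zero element 0 ≠ 1 (reduced means: if gⁿ = 0 for some n ≥ 1 then g = 0). Then the set M* of non-zerodivisors of M (elements f such that f·g = 0 implies g = 0) is equal to the intersection of all ultrafilters of M. -/
/-- An *ultrafilter* in a commutative monoid with zero: a maximal element among
the consistent filters (those not containing `0`). -/
def IsUltraMulFilter {M : Type*} [CommMonoidWithZero M] (F : Set M) : Prop :=
  IsMulFilter F ∧ (0 : M) ∉ F ∧
    ∀ G : Set M, IsMulFilter G → (0 : M) ∉ G → F ⊆ G → G = F

/-- The set of divisors of elements of a submonoid is a filter. -/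
theorem Submonoid.isMulFilter_divisors {A : Type*} [CommMonoid A] (S : Submonoid A) :
    IsMulFilter {x : A | ∃ s ∈ S, x ∣ s} := by
  refine ⟨⟨1, S.one_mem, dvd_rfl⟩, ?_, ?_⟩
  · rintro x ⟨s, hs, hxs⟩ y ⟨t, ht, hyt⟩
    exact ⟨s * t, S.mul_mem hs ht, mul_dvd_mul hxs hyt⟩
  · rintro x ⟨s, hs, hxs⟩ y hyx
    exact ⟨s, hs, hyx.trans hxs⟩

/-- A nonempty chain of filters has a filter as its union. -/
theorem IsMulFilter.sUnion_of_isChain {A : Type*} [CommMonoid A] {c : Set (Set A)}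
    (hc : ∀ F ∈ c, IsMulFilter F) (hchain : IsChain (· ⊆ ·) c) (hne : c.Nonempty) :
    IsMulFilter (⋃₀ c) := by
  obtain ⟨F₀, hF₀⟩ := hne
  refine ⟨⟨F₀, hF₀, (hc F₀ hF₀).1⟩, ?_, ?_⟩
  · rintro x ⟨F, hF, hx⟩ y ⟨G, hG, hy⟩
    rcases hchain.total hF hG with h | h
    · exact ⟨G, hG, (hc G hG).2.1 x (h hx) y hy⟩
    · exact ⟨F, hF, (hc F hF).2.1 x hx y (h hy)⟩
  · rintro x ⟨F, hF, hx⟩ y hyx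
    exact ⟨F, hF, (hc F hF).2.2 x hx y hyx⟩

/-- Every consistent filter is contained in an ultrafilter. -/
theorem IsMulFilter.exists_isUltraMulFilter {M : Type*} [CommMonoidWithZero M] {F : Set M}
    (hF : IsMulFilter F) (h0 : (0 : M) ∉ F) : ∃ U, F ⊆ U ∧ IsUltraMulFilter U := by
  obtain ⟨U, hFU, hU⟩ := zorn_subset_nonempty {G : Set M | IsMulFilter G ∧ (0 : M) ∉ G}
    (fun c hc hchain hne ↦ ⟨⋃₀ c,
      ⟨.sUnion_of_isChain (fun G hG ↦ (hc hG).1) hchain hne,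
        fun ⟨G, hG, h⟩ ↦ (hc hG).2 h⟩,
      fun _ ↦ Set.subset_sUnion_of_mem⟩) F ⟨hF, h0⟩
  exact ⟨U, hFU, hU.prop.1, hU.prop.2, fun G hG hG0 hUG ↦ (hU.eq_of_subset ⟨hG, hG0⟩ hUG).symm⟩

/-- Every ultrafilter contains all non-zerodivisors. -/
theorem IsUltraMulFilter.mem_of_forall_mul_eq_zero {M : Type*} [CommMonoidWithZero M] {F : Set M}
    (hF : IsUltraMulFilter F) {f : M} (hf : ∀ g : M, f * g = 0 → g = 0) : f ∈ F := by
  obtain ⟨⟨h1, hmul, -⟩, h0, hmax⟩ := hF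
  let S : Submonoid M := ⟨⟨F, fun {a b} ha hb ↦ hmul a ha b hb⟩, h1⟩
  have hpow : ∀ (n : ℕ) (a : M), f ^ n * a = 0 → a = 0 := by
    intro n
    induction n with
    | zero => simp
    | succ n ih => exact fun a ha ↦ ih a (hf _ (by rw [← mul_assoc, ← pow_succ', ha]))
  rw [← hmax _ (Submonoid.powers f ⊔ S).isMulFilter_divisors ?_ ?_]
  · exact ⟨f, Submonoid.mem_sup_left (Submonoid.mem_powers f), dvd_rfl⟩
  · rintro ⟨s, hs, h⟩
    obtain ⟨_, ⟨n, rfl⟩, a, ha, rfl⟩ := Submonoid.mem_sup.1 hs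
    exact h0 (hpow n a (zero_dvd_iff.1 h) ▸ ha)
  · exact fun a ha ↦ ⟨a, Submonoid.mem_sup_right ha, dvd_rfl⟩

theorem stmt5 {M : Type*} [CommMonoidWithZero M] (h01 : (0 : M) ≠ 1)
    (hred : ∀ (g : M) (n : ℕ), 1 ≤ n → g ^ n = 0 → g = 0) :
    {f : M | ∀ g : M, f * g = 0 → g = 0} = ⋂₀ {F : Set M | IsUltraMulFilter F} := by
  refine Set.Subset.antisymm (fun f hf F hF ↦ hF.mem_of_forall_mul_eq_zero hf) ?_
  intro f hf g hfg
  by_contra hg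
  obtain ⟨U, hgU, hU⟩ := (Submonoid.powers g).isMulFilter_divisors.exists_isUltraMulFilter (by
    rintro ⟨_, ⟨n, rfl⟩, h⟩
    have hn : g ^ n = 0 := zero_dvd_iff.1 h
    rcases Nat.eq_zero_or_pos n with rfl | hpos
    · exact h01 (by rw [← hn, pow_zero])
    · exact hg (hred g n hpos hn))
  have hmul := hU.1.2.1 f (hf U hU) g (hgU ⟨g, Submonoid.mem_powers g, dvd_rfl⟩)
  exact hU.2.1 (hfg ▸ hmul)
end

section
/- Let A be a normal (integrally closed) Noetherian integral domain and f ∈ A, f ≠ 0. Then the principal filter F(f) = {g ∈ A : g divides some power of f} contains only finitely many irreducible elements up to association; that is, there exist finitely many irreducible elements p₁,…,pₙ ∈ F(f) such that every irreducible element of F(f) is associated to some pᵢ. -/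
open IsLocalRing in
/-- A Noetherian integrally closed local domain whose maximal ideal annihilates a nonzero element
of `R ⧸ (f)`, with `f ≠ 0`, is a discrete valuation ring. -/
theorem isDiscreteValuationRing_of_dvd_mul_of_mem_maximalIdeal {R : Type*} [CommRing R]
    [IsDomain R] [IsLocalRing R] [IsNoetherianRing R] [IsIntegrallyClosed R] {f x : R}
    (hf : f ≠ 0) (hx : ¬ f ∣ x) (h : ∀ a ∈ maximalIdeal R, f ∣ a * x) :
    IsDiscreteValuationRing R := by
  have hfm : f ∈ maximalIdeal R := (mem_maximalIdeal f).2 fun hu => hx hu.dvd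
  have hR : ¬ IsField R := fun hR => hx <| by
    obtain ⟨y, hy⟩ := hR.mul_inv_cancel hf
    exact (IsUnit.of_mul_eq_one y hy).dvd
  refine ((IsDiscreteValuationRing.TFAE R hR).out 0 4).2 ?_
  by_cases hc : ∃ a ∈ maximalIdeal R, ∃ u, IsUnit u ∧ a * x = f * u
  · obtain ⟨a, ha, u, hu, hau⟩ := hc
    refine ⟨a, le_antisymm (fun b hb => ?_) ?_⟩
    · obtain ⟨c, hbc⟩ := h b hb
      refine Ideal.mem_span_singleton.2 ((hu.dvd_mul_right).1 ⟨c, ?_⟩)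
      refine mul_left_cancel₀ hf ?_
      linear_combination a * hbc - b * hau
    · exact (Ideal.span_singleton_le_iff_mem _).2 ha
  · push Not at hc
    exfalso
    have hfK : algebraMap R (FractionRing R) f ≠ 0 := IsFractionRing.to_map_eq_zero_iff.not.mpr hf
    let y : FractionRing R := algebraMap R (FractionRing R) x / algebraMap R (FractionRing R) f
    have hy : IsIntegral R y := by
      refine isIntegral_of_smul_mem_submodule
        (Submodule.map (Algebra.linearMap R (FractionRing R)) (maximalIdeal R)) ?_ ?_ y ?_
      · exact (Submodule.ne_bot_iff _).2 ⟨_, ⟨f, hfm, rfl⟩, hfK⟩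
      · exact Submodule.FG.map _ (IsNoetherian.noetherian _)
      · rintro _ ⟨a, ha, rfl⟩
        obtain ⟨c, hac⟩ := h a ha
        refine ⟨c, (mem_maximalIdeal c).2 fun hu => hc a ha c hu hac, ?_⟩
        have := congrArg (algebraMap R (FractionRing R)) hac
        simp only [map_mul] at this
        simp only [Algebra.linearMap_apply, smul_eq_mul, y]
        field_simp
        linear_combination -this
    obtain ⟨z, hz⟩ := IsIntegrallyClosed.algebraMap_eq_of_integral hy
    refine hx ⟨z, IsFractionRing.injective R (FractionRing R) ?_⟩
    rw [map_mul, hz, mul_div_cancel₀ _ hfK]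

/-- In a Noetherian normal domain, divisibility localized at a prime ideal `Q = ((f) : x)` with
`f ≠ 0` is governed by a discrete valuation. -/
theorem exists_valuation_of_colon_singleton {A : Type*} [CommRing A] [IsDomain A]
    [IsIntegrallyClosed A] [IsNoetherianRing A] {f x : A} (hf : f ≠ 0) (Q : Ideal A) [Q.IsPrime]
    (hQ : ∀ a, a ∈ Q ↔ f ∣ a * x) :
    ∃ v : A → ℕ∞, ∀ g h, v g ≤ v h → ∃ s ∉ Q, g ∣ s * h := by
  let R := Localization.AtPrime Q
  have : IsIntegrallyClosed R :=
    isIntegrallyClosed_of_isLocalization R Q.primeCompl Q.primeCompl_le_nonZeroDivisors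
  have : IsNoetherianRing R := IsLocalization.isNoetherianRing Q.primeCompl R inferInstance
  have key : ∀ g h : A, algebraMap A R g ∣ algebraMap A R h → ∃ s ∉ Q, g ∣ s * h := by
    rintro g h ⟨c, hc⟩
    obtain ⟨⟨b, s⟩, hs⟩ := IsLocalization.surj Q.primeCompl c
    refine ⟨s, s.2, b, IsLocalization.injective R Q.primeCompl_le_nonZeroDivisors ?_⟩
    simp only [map_mul] at hs ⊢
    linear_combination algebraMap A R s * hc + algebraMap A R g * hs
  have : IsDiscreteValuationRing R := by
    refine isDiscreteValuationRing_of_dvd_mul_of_mem_maximalIdeal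
      (f := algebraMap A R f) (x := algebraMap A R x)
      ?_ ?_ fun a ha => ?_
    · rwa [Ne, IsLocalization.to_map_eq_zero_iff R Q.primeCompl_le_nonZeroDivisors]
    · intro hd
      obtain ⟨s, hs, hd⟩ := key _ _ hd
      exact hs ((hQ s).2 hd)
    · obtain ⟨⟨b, s⟩, hs⟩ := IsLocalization.surj Q.primeCompl a
      have hsu := IsLocalization.map_units R s
      have hb : b ∈ Q := by
        rw [← IsLocalization.AtPrime.to_map_mem_maximal_iff R Q b, ← hs]
        exact Ideal.mul_mem_right _ _ ha
      obtain ⟨c, hc⟩ := (hQ b).1 hb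
      refine (hsu.dvd_mul_left).1 ⟨algebraMap A R c, ?_⟩
      have := congrArg (algebraMap A R) hc
      simp only [map_mul] at this hs
      linear_combination this + algebraMap A R x * hs
  exact ⟨fun g => IsDiscreteValuationRing.addVal R (algebraMap A R g),
    fun g h hgh => key g h (IsDiscreteValuationRing.addVal_le_iff_dvd.1 hgh)⟩

theorem Ideal.Quotient.mem_colon_bot_mk_singleton {A : Type*} [CommRing A] {f a x : A} :
    a ∈ (⊥ : Submodule A (A ⧸ Ideal.span {f})).colon {Ideal.Quotient.mk (Ideal.span {f}) x} ↔
      f ∣ a * x := by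
  rw [Submodule.mem_colon_singleton, Submodule.mem_bot, ← Ideal.mem_span_singleton,
    ← Ideal.Quotient.eq_zero_iff_mem, map_mul]
  rfl

/-- An associated prime of a divisor of a power of `f` is an associated prime of `f`. -/
theorem IsAssociatedPrime.of_dvd_pow {A : Type*} [CommRing A] [IsDomain A] [IsNoetherianRing A]
    {f g : A} (hf : f ≠ 0) {m : ℕ} (hg : g ∣ f ^ m) {Q : Ideal A}
    (hQ : IsAssociatedPrime Q (A ⧸ Ideal.span {g})) :
    IsAssociatedPrime Q (A ⧸ Ideal.span {f}) := by
  rw [isAssociatedPrime_iff] at hQ ⊢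
  obtain ⟨hp, x, hx⟩ := hQ
  obtain ⟨x, rfl⟩ := Ideal.Quotient.mk_surjective x
  have hQ (a : A) : a ∈ Q ↔ g ∣ a * x := by
    rw [hx]; exact Ideal.Quotient.mem_colon_bot_mk_singleton
  have hfm : f ^ m ∈ Q := (hQ _).2 (hg.mul_right x)
  have hfQ : f ∈ Q := hp.mem_of_pow_mem m hfm
  obtain ⟨d, hd⟩ := hg
  have hd0 : d ≠ 0 := by rintro rfl; simp [hf] at hd
  cases m with
  | zero => exact absurd ((Ideal.eq_top_iff_one Q).2 (by simpa using hfm)) hp.ne_top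
  | succ m =>
    obtain ⟨c, hc⟩ := (hQ f).1 hfQ
    have hdx : d * x = f ^ m * c := mul_left_cancel₀ hf <| by
      linear_combination d * hc - c * hd
    refine ⟨hp, Ideal.Quotient.mk _ c, ?_⟩
    ext a
    rw [hQ, Ideal.Quotient.mem_colon_bot_mk_singleton, ← mul_dvd_mul_iff_left hd0, mul_comm d g,
      ← hd, mul_left_comm d, hdx, mul_left_comm a, pow_succ,
      mul_dvd_mul_iff_left (pow_ne_zero m hf)]

theorem stmt12 {A : Type*} [CommRing A] [IsDomain A] [IsIntegrallyClosed A]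
    [IsNoetherianRing A] (f : A) (hf : f ≠ 0) :
    ∃ (n : ℕ) (p : Fin n → A),
      (∀ i, Irreducible (p i) ∧ ∃ m : ℕ, p i ∣ f ^ m) ∧
      ∀ g : A, (∃ m : ℕ, g ∣ f ^ m) → Irreducible g → ∃ i, Associated g (p i) := by
  let P := associatedPrimes A (A ⧸ Ideal.span {f})
  have : Finite P := associatedPrimes.finite A (A ⧸ Ideal.span {f})
  have hval (Q : P) : ∃ v : A → ℕ∞, ∀ g h, v g ≤ v h → ∃ s ∉ Q.1, g ∣ s * h := by
    obtain ⟨hp, x, hx⟩ := isAssociatedPrime_iff.1 Q.2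
    obtain ⟨x, rfl⟩ := Ideal.Quotient.mk_surjective x
    exact exists_valuation_of_colon_singleton (x := x) hf Q.1 fun a => by
      rw [hx]; exact Ideal.Quotient.mem_colon_bot_mk_singleton
  choose v hv using hval
  let w (g : A) (Q : P) : ℕ∞ := v Q g
  have dvd_of_le {g h : A} {m : ℕ} (hg : g ∣ f ^ m) (hgh : w g ≤ w h) : g ∣ h := by
    by_contra hnd
    obtain ⟨Q, hQ, hle⟩ := exists_le_isAssociatedPrime_of_isNoetherianRing A
      (Ideal.Quotient.mk (Ideal.span {g}) h)
      (by rwa [Ne, Ideal.Quotient.eq_zero_iff_mem, Ideal.mem_span_singleton])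
    obtain ⟨s, hs, hd⟩ := hv ⟨Q, hQ.of_dvd_pow hf hg⟩ g h (hgh _)
    exact hs (hle (Ideal.Quotient.mem_colon_bot_mk_singleton.2 hd))
  let S : Set (Associates A) := {a | Irreducible (Quot.out a) ∧ ∃ m : ℕ, Quot.out a ∣ f ^ m}
  have hS : S.Finite := by
    refine IsAntichain.finite_of_wellQuasiOrdered
      (r := fun a b : Associates A => w (Quot.out a) ≤ w (Quot.out b)) ?_
      fun s => wellQuasiOrdered_le fun n => w (Quot.out (s n))
    rintro a ⟨ha, m, hm⟩ b ⟨hb, -⟩ hab hle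
    refine hab ?_
    have := Associates.mk_eq_mk_iff_associated.2 (ha.associated_of_dvd hb (dvd_of_le hm hle))
    rwa [Associates.quot_out, Associates.quot_out] at this
  have := hS.to_subtype
  obtain ⟨n, ⟨e⟩⟩ := Finite.exists_equiv_fin S
  refine ⟨n, fun i => Quot.out (e.symm i).1, fun i => (e.symm i).2, fun g ⟨m, hm⟩ hg => ?_⟩
  have hgo : Associated g (Quot.out (Associates.mk g)) := by
    rw [← Associates.mk_eq_mk_iff_associated, Associates.quot_out]
  refine ⟨e ⟨Associates.mk g, hgo.irreducible hg, m, hgo.dvd_iff_dvd_left.1 hm⟩, ?_⟩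
  simpa using hgo
end

section
/- Let A be a normal (integrally closed) Noetherian integral domain, f ∈ A with f ≠ 0, and G ⊆ A an arbitrary filter. Then the intersection F(f) ∩ G is again a principal filter: there exists h ∈ A with F(f) ∩ G = F(h). In particular, the intersection of two principal filters of A is a principal filter. -/
/-- The divisors of powers of an element form a filter. -/
theorem isMulFilter_setOf_dvd_pow {A : Type*} [CommMonoid A] (f : A) :
    IsMulFilter {g : A | ∃ n : ℕ, g ∣ f ^ n} := by
  refine ⟨⟨0, one_dvd _⟩, ?_, ?_⟩
  · rintro a ⟨m, hm⟩ b ⟨n, hn⟩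
    exact ⟨m + n, pow_add f m n ▸ mul_dvd_mul hm hn⟩
  · rintro a ⟨m, hm⟩ b hb
    exact ⟨m, hb.trans hm⟩

/-- An element of a filter has all divisors of its powers in that filter. -/
theorem IsMulFilter.setOf_dvd_pow_subset {A : Type*} [CommMonoid A] {F : Set A}
    (hF : IsMulFilter F) {h : A} (hh : h ∈ F) : {g : A | ∃ n : ℕ, g ∣ h ^ n} ⊆ F := by
  have hpow : ∀ n : ℕ, h ^ n ∈ F := by
    intro n
    induction n with
    | zero => simpa using hF.1
    | succ k ih => exact pow_succ h k ▸ hF.2.1 _ ih _ hh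
  rintro g ⟨n, hn⟩
  exact hF.2.2 _ (hpow n) g hn

/-- The intersection of two filters is a filter. -/
theorem IsMulFilter.inter {A : Type*} [CommMonoid A] {F G : Set A}
    (hF : IsMulFilter F) (hG : IsMulFilter G) : IsMulFilter (F ∩ G) :=
  ⟨⟨hF.1, hG.1⟩, fun a ha b hb => ⟨hF.2.1 a ha.1 b hb.1, hG.2.1 a ha.2 b hb.2⟩,
    fun a ha b hb => ⟨hF.2.2 a ha.1 b hb, hG.2.2 a ha.2 b hb⟩⟩

/-- By Krull's principal ideal theorem, a prime minimal over `g` that contains a nonzero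
element `f` is minimal over `f`. -/
theorem Ideal.mem_minimalPrimes_span_singleton_of_mem {A : Type*} [CommRing A] [IsDomain A]
    [IsNoetherianRing A] {f g : A} (hf : f ≠ 0) {P : Ideal A}
    (hP : P ∈ (Ideal.span {g}).minimalPrimes) (hfP : f ∈ P) :
    P ∈ (Ideal.span {f}).minimalPrimes := by
  have := hP.isPrime
  exact Ideal.mem_minimalPrimes_of_height_le
    ((Ideal.span_singleton_le_iff_mem P).mpr hfP)
    ((Ideal.height_le_one_of_isPrincipal_of_mem_minimalPrimes _ P hP).trans
      (Ideal.one_le_height_span_singleton_of_mem_nonZeroDivisors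
        (mem_nonZeroDivisors_of_ne_zero hf)))

/-- An element divides a power of `h` as soon as `h` lies in all its minimal primes. -/
theorem exists_dvd_pow_of_forall_minimalPrimes {A : Type*} [CommRing A] {g h : A}
    (H : ∀ P ∈ (Ideal.span {g}).minimalPrimes, h ∈ P) : ∃ n : ℕ, g ∣ h ^ n := by
  have hmem : h ∈ (Ideal.span {g}).radical := by
    rw [← Ideal.sInf_minimalPrimes]
    exact (Submodule.mem_sInf).mpr H
  obtain ⟨n, hn⟩ := hmem
  exact ⟨n, Ideal.mem_span_singleton.mp hn⟩

/-- In a Noetherian domain, the intersection of the filter of divisors of powers of a nonzero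
element with any filter is principal. -/
theorem IsMulFilter.exists_inter_eq_setOf_dvd_pow {A : Type*} [CommRing A] [IsDomain A]
    [IsNoetherianRing A] {f : A} (hf : f ≠ 0) {G : Set A} (hG : IsMulFilter G) :
    ∃ h : A, {g : A | ∃ n : ℕ, g ∣ f ^ n} ∩ G = {g : A | ∃ n : ℕ, g ∣ h ^ n} := by
  have hI := (isMulFilter_setOf_dvd_pow f).inter hG
  let S : A → Set (Ideal A) := fun g => {P ∈ (Ideal.span {f}).minimalPrimes | g ∈ P}
  have hfin : (S '' ({g : A | ∃ n : ℕ, g ∣ f ^ n} ∩ G)).Finite := by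
    refine (Ideal.finite_minimalPrimes_of_isNoetherianRing A
      (Ideal.span {f})).finite_subsets.subset ?_
    rintro _ ⟨g, -, rfl⟩
    exact Set.sep_subset _ _
  obtain ⟨h, hh, hmax⟩ := Set.Finite.exists_maximalFor' S _ hfin ⟨1, hI.1⟩
  refine ⟨h, Set.Subset.antisymm (fun g hg => ?_) (hI.setOf_dvd_pow_subset hh)⟩
  refine exists_dvd_pow_of_forall_minimalPrimes fun P hP => ?_
  have := hP.isPrime
  have hgP : g ∈ P := hP.le (Ideal.mem_span_singleton_self g)
  obtain ⟨n, hn⟩ := hg.1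
  have hfP : f ∈ P := this.mem_of_pow_mem n (P.mem_of_dvd hn hgP)
  have hle : S (g * h) ⊆ S h := hmax (hI.2.1 g hg h hh) fun Q hQ => ⟨hQ.1, Q.mul_mem_left g hQ.2⟩
  exact (hle ⟨Ideal.mem_minimalPrimes_span_singleton_of_mem hf hP hfP,
    P.mul_mem_right h hgP⟩).2

theorem stmt13 {A : Type*} [CommRing A] [IsDomain A] [IsIntegrallyClosed A]
    [IsNoetherianRing A] (f : A) (hf : f ≠ 0) (G : Set A) (hG : IsMulFilter G) :
    (∃ h : A, {g : A | ∃ n : ℕ, g ∣ f ^ n} ∩ G = {g : A | ∃ n : ℕ, g ∣ h ^ n}) ∧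
    (∀ f₁ f₂ : A, ∃ h : A,
      {g : A | ∃ n : ℕ, g ∣ f₁ ^ n} ∩ {g : A | ∃ n : ℕ, g ∣ f₂ ^ n} =
        {g : A | ∃ n : ℕ, g ∣ h ^ n}) := by
  refine ⟨hG.exists_inter_eq_setOf_dvd_pow hf, fun f₁ f₂ => ?_⟩
  rcases eq_or_ne f₁ 0 with rfl | hf₁
  · exact ⟨f₂, Set.inter_eq_right.mpr fun g _ => ⟨1, by simp⟩⟩
  · exact (isMulFilter_setOf_dvd_pow f₂).exists_inter_eq_setOf_dvd_pow hf₁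
end

section
/- Let A be a commutative ring, g ∈ A, and (f_i)_{i ∈ I} a family of elements of A. Then the following are equivalent: (1) F(g) = ⋂_{i ∈ I} F(f_i); (2) the ideal generated by the f_i is contained in the radical of the principal ideal (g), and for every h ∈ A such that the ideal generated by the f_i is contained in the radical of (h), one has Rad(g) ⊆ Rad(h); i.e. g defines a smallest radical of a principal ideal containing all the f_i. -/
theorem mem_radical_span_singleton_iff_exists_dvd_pow {A : Type*} [CommRing A] {x y : A} :
    y ∈ (Ideal.span {x}).radical ↔ ∃ n : ℕ, x ∣ y ^ n := by
  simp only [Ideal.mem_radical_iff, Ideal.mem_span_singleton]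

theorem span_range_le_radical_span_singleton_iff {A : Type*} [CommRing A] {I : Type*}
    {f : I → A} {x : A} :
    Ideal.span (Set.range f) ≤ (Ideal.span {x}).radical ↔ ∀ i, ∃ n : ℕ, x ∣ f i ^ n := by
  simp only [Ideal.span_le, Set.range_subset_iff, SetLike.mem_coe,
    mem_radical_span_singleton_iff_exists_dvd_pow]

theorem radical_span_singleton_le_iff {A : Type*} [CommRing A] {x y : A} :
    (Ideal.span {y}).radical ≤ (Ideal.span {x}).radical ↔ ∃ n : ℕ, x ∣ y ^ n := by
  rw [Ideal.radical_le_radical_iff, Ideal.span_singleton_le_iff_mem,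
    mem_radical_span_singleton_iff_exists_dvd_pow]

theorem stmt14 {A : Type*} [CommRing A] {I : Type*} (g : A) (f : I → A) :
    {x : A | ∃ n : ℕ, x ∣ g ^ n} = ⋂ i : I, {x : A | ∃ n : ℕ, x ∣ (f i) ^ n} ↔
    (Ideal.span (Set.range f) ≤ (Ideal.span {g}).radical ∧
      ∀ h : A, Ideal.span (Set.range f) ≤ (Ideal.span {h}).radical →
        (Ideal.span {g}).radical ≤ (Ideal.span {h}).radical) := by
  simp only [Set.ext_iff, Set.mem_iInter, Set.mem_ofPred_eq,
    span_range_le_radical_span_singleton_iff, radical_span_singleton_le_iff]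
  refine ⟨fun H => ⟨(H g).1 ⟨1, by simp⟩, fun h => (H h).2⟩, ?_⟩
  rintro ⟨hg, hmin⟩ x
  refine ⟨fun ⟨n, hn⟩ i => ?_, hmin x⟩
  obtain ⟨m, hm⟩ := hg i
  exact ⟨m * n, hn.trans (pow_mul (f i) m n ▸ pow_dvd_pow_of_dvd hm n)⟩
end

section
/- Let A be an integral domain with fraction field Q in which every element of Q admits a representation with coprime numerator and denominator (for every q ∈ Q there exist a, h ∈ A, h ≠ 0, with q = a/h and Aa ∩ Ah = Aah). If f, g ∈ A are nonzero elements with F(f) ∩ F(g) = A^×, then f and g are coprime, i.e. Af ∩ Ag = Afg. -/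
theorem stmt16 {A : Type*} [CommRing A] [IsDomain A]
    (hrep : ∀ q : FractionRing A, ∃ a h : A, h ≠ 0 ∧
      q = algebraMap A (FractionRing A) a / algebraMap A (FractionRing A) h ∧
      Ideal.span {a} ⊓ Ideal.span {h} = Ideal.span {a * h})
    (f g : A) (hf : f ≠ 0) (hg : g ≠ 0)
    (hfil : {x : A | ∃ n : ℕ, x ∣ f ^ n} ∩ {x : A | ∃ n : ℕ, x ∣ g ^ n} =
      {u : A | IsUnit u}) :
    Ideal.span {f} ⊓ Ideal.span {g} = Ideal.span {f * g} := by
  obtain ⟨a, h, hh, hq, hcop⟩ := hrep (algebraMap A _ f / algebraMap A _ g)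
  have inj := IsFractionRing.injective A (FractionRing A)
  have hg' : algebraMap A (FractionRing A) g ≠ 0 := by
    simpa using inj.ne hg
  have hh' : algebraMap A (FractionRing A) h ≠ 0 := by
    simpa using inj.ne hh
  have hcross : f * h = a * g := by
    rw [div_eq_div_iff hg' hh'] at hq
    apply inj
    simpa using hq
  have ha : a ≠ 0 := by
    rintro rfl
    simp [hf, hh] at hcross
  have hmem : f * h ∈ Ideal.span {a} ⊓ Ideal.span {h} :=
    ⟨Ideal.mem_span_singleton.2 ⟨g, hcross⟩, Ideal.mem_span_singleton.2 ⟨f, mul_comm _ _⟩⟩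
  rw [hcop, Ideal.mem_span_singleton] at hmem
  obtain ⟨k, hk⟩ := hmem
  have hfk : f = a * k := mul_right_cancel₀ hh (by rw [hk]; ring)
  have hgk : g = h * k := mul_left_cancel₀ ha (by rw [← hcross, hk]; ring)
  have hku : IsUnit k := by
    have hk_mem : k ∈ {x : A | ∃ n : ℕ, x ∣ f ^ n} ∩ {x : A | ∃ n : ℕ, x ∣ g ^ n} :=
      ⟨⟨1, a, by rw [hfk]; ring⟩, ⟨1, h, by rw [hgk]; ring⟩⟩
    rwa [hfil] at hk_mem
  rw [hfk, hgk, Ideal.span_singleton_mul_right_unit hku, Ideal.span_singleton_mul_right_unit hku,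
    hcop, show a * k * (h * k) = a * h * (k * k) by ring,
    Ideal.span_singleton_mul_right_unit (hku.mul hku)]
end

section
/- Let A be a commutative ring. Then the set of minimal prime ideals of A, viewed as a subspace of the prime spectrum Spec A with the Zariski topology, is dense in Spec A, is a Hausdorff space, and is totally disconnected (its only nonempty connected subsets are singletons). -/
/-- An element of a minimal prime is annihilated, up to a power, by an element outside it. -/
theorem exists_notMem_mul_pow_eq_zero {A : Type*} [CommRing A] {p : Ideal A}
    (hp : p ∈ minimalPrimes A) {f : A} (hf : f ∈ p) :
    ∃ s ∉ p, ∃ n : ℕ, s * f ^ n = 0 := by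
  have : p.IsPrime := hp.1.1
  by_contra! h
  let S : Submonoid A := p.primeCompl ⊔ Submonoid.powers f
  have hS : Disjoint ((⊥ : Ideal A) : Set A) S := by
    rw [Set.disjoint_left]
    rintro x hx hxS
    obtain ⟨s, hs, _, ⟨n, rfl⟩, rfl⟩ := Submonoid.mem_sup.mp hxS
    exact h s hs n (by simpa using hx)
  obtain ⟨q, hq, -, hqS⟩ := Ideal.exists_le_prime_disjoint _ S hS
  rw [Set.disjoint_left] at hqS
  have hqp : q ≤ p := fun x hx ↦ by
    by_contra hxp
    exact hqS hx (Submonoid.mem_sup_left hxp)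
  exact hqS (hp.2 ⟨hq, bot_le⟩ hqp hf)
    (Submonoid.mem_sup_right (Submonoid.mem_powers f))

/-- The trace of a basic open set on the space of minimal primes is clopen. -/
theorem isClopen_basicOpen_minimalPrimes {A : Type*} [CommRing A] (f : A) :
    IsClopen {p : {p : PrimeSpectrum A | p.asIdeal ∈ minimalPrimes A} | f ∉ p.1.asIdeal} := by
  refine ⟨⟨isOpen_iff_forall_mem_open.mpr fun p hp ↦ ?_⟩,
    (PrimeSpectrum.isOpen_basicOpen (a := f)).preimage continuous_subtype_val⟩
  obtain ⟨s, hs, n, hsn⟩ := exists_notMem_mul_pow_eq_zero p.2 (not_not.mp hp)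
  refine ⟨_, fun q hq ↦ ?_,
    (PrimeSpectrum.isOpen_basicOpen (a := s)).preimage continuous_subtype_val, hs⟩
  have hmem : s * f ^ n ∈ q.1.asIdeal := hsn ▸ q.1.asIdeal.zero_mem
  exact not_not.mpr (q.1.isPrime.mem_of_pow_mem n ((q.1.isPrime.mem_or_mem hmem).resolve_left hq))

theorem totallySeparatedSpace_minimalPrimes (A : Type*) [CommRing A] :
    TotallySeparatedSpace {p : PrimeSpectrum A | p.asIdeal ∈ minimalPrimes A} := by
  refine totallySeparatedSpace_iff_exists_isClopen.mpr fun p q hpq ↦ ?_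
  obtain ⟨f, hfq, hfp⟩ : ∃ f ∈ q.1.asIdeal, f ∉ p.1.asIdeal := by
    by_contra! h
    have hqp : q.1.asIdeal ≤ p.1.asIdeal := h
    exact hpq (Subtype.ext (PrimeSpectrum.ext
      ((p.2.2 ⟨q.1.isPrime, bot_le⟩ hqp).antisymm hqp)))
  exact ⟨_, isClopen_basicOpen_minimalPrimes f, hfp, not_not.mpr hfq⟩

theorem dense_minimalPrimes (A : Type*) [CommRing A] :
    Dense {p : PrimeSpectrum A | p.asIdeal ∈ minimalPrimes A} := by
  intro p
  obtain ⟨q, hq, hqp⟩ := Ideal.exists_minimalPrimes_le (I := ⊥) (J := p.asIdeal) bot_le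
  let x : PrimeSpectrum A := ⟨q, hq.1.1⟩
  exact ((PrimeSpectrum.le_iff_specializes x p).mp hqp).mem_closed isClosed_closure
    (subset_closure hq)

theorem stmt17 {A : Type*} [CommRing A] :
    Dense {p : PrimeSpectrum A | p.asIdeal ∈ minimalPrimes A} ∧
    T2Space {p : PrimeSpectrum A | p.asIdeal ∈ minimalPrimes A} ∧
    TotallyDisconnectedSpace {p : PrimeSpectrum A | p.asIdeal ∈ minimalPrimes A} := by
  have := totallySeparatedSpace_minimalPrimes A
  exact ⟨dense_minimalPrimes A, inferInstance, inferInstance⟩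
end
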